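/- arXiv:0804.1012 — 3 statements merged into one kernel-verified Lean document; each statement's English description precedes it below -/
import Mathlib

section
/- The ring k[𝔖_ℚ] = k[{C_a, S_a : a ∈ ℚ}] (with the addition-formula relations) is not Noetherian: the ideal generated by {S_{1/2^n} : n ∈ ℕ} is not finitely generated. Concretely, in the directed union ⋃_n k[z^{1/2^n}, z^{-1/2^n}], the ideal generated by {z^{1/2^n} - z^{-1/2^n} : n ∈ ℕ} is not finitely generated. -/
theorem aux_unit {k G : Type*} [Field k] [AddCommGroup G] [TwoUniqueSums G] (a : G)
    (ha : a ≠ -a) (f : AddMonoidAlgebra k G)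
    (h : f * (AddMonoidAlgebra.single a 1 + AddMonoidAlgebra.single (-a) 1) = 1) : False := by
  classical
  set g : AddMonoidAlgebra k G := AddMonoidAlgebra.single a 1 + AddMonoidAlgebra.single (-a) 1
    with hg
  have hf : f ≠ 0 := by
    rintro rfl
    simp at h
  have h1 : 0 < f.coeff.support.card := by
    rw [Finset.card_pos, Finsupp.support_nonempty_iff]
    simpa using hf
  have ga : g.coeff a ≠ 0 := by
    simp [hg, Finsupp.single_apply, ha.symm]
  have gb : g.coeff (-a) ≠ 0 := by
    simp [hg, Finsupp.single_apply, ha]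
  have h2 : 1 < g.coeff.support.card :=
    Finset.one_lt_card.2 ⟨a, Finsupp.mem_support_iff.2 ga, -a, Finsupp.mem_support_iff.2 gb, ha⟩
  obtain ⟨p, hp, q, hq, hne, up, uq⟩ :=
    TwoUniqueSums.uniqueAdd_of_one_lt_card (A := f.coeff.support) (B := g.coeff.support)
      (by nlinarith)
  rw [Finset.mem_product] at hp hq
  have key : ∀ r : G × G, r.1 ∈ f.coeff.support → r.2 ∈ g.coeff.support →
      UniqueAdd f.coeff.support g.coeff.support r.1 r.2 → r.1 + r.2 = 0 := by
    intro r hr1 hr2 ur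
    have e := AddMonoidAlgebra.coeff_mul_add_of_uniqueAdd ur
    rw [h] at e
    by_contra hr
    have : (1 : AddMonoidAlgebra k G).coeff (r.1 + r.2) = 0 := by
      rw [AddMonoidAlgebra.one_def]
      simp [Finsupp.single_apply, Ne.symm hr]
    rw [this] at e
    exact mul_ne_zero (Finsupp.mem_support_iff.1 hr1) (Finsupp.mem_support_iff.1 hr2) e.symm
  have e := up hq.1 hq.2 ((key q hq.1 hq.2 uq).trans (key p hp.1 hp.2 up).symm)
  exact hne (Prod.ext e.1.symm e.2.symm)

theorem aux_main {k G : Type*} [Field k] [AddCommGroup G] [TwoUniqueSums G] (x : ℕ → G)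
    (hx : ∀ n, x n = x (n + 1) + x (n + 1)) (hne : ∀ n, x n ≠ -x n) :
    ¬ (Ideal.span {f : AddMonoidAlgebra k G | ∃ n : ℕ,
      f = AddMonoidAlgebra.single (x n) 1 - AddMonoidAlgebra.single (-x n) 1}).FG := by
  intro hFG
  set s : ℕ → AddMonoidAlgebra k G := fun n =>
    AddMonoidAlgebra.single (x n) 1 - AddMonoidAlgebra.single (-x n) 1 with hs
  have hmul : ∀ n, s n = (AddMonoidAlgebra.single (x (n+1)) 1 +
      AddMonoidAlgebra.single (-x (n+1)) 1) * s (n+1) := by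
    intro n
    simp only [hs, mul_sub, add_mul, AddMonoidAlgebra.single_mul_single, hx n]
    simp
    abel
  have mono : Monotone fun n => Ideal.span {s n} := by
    refine monotone_nat_of_le_succ fun n => ?_
    rw [Ideal.span_singleton_le_span_singleton]
    exact ⟨_, (hmul n).trans (mul_comm _ _)⟩
  obtain ⟨N, hN⟩ := Submodule.FG.stabilizes_of_iSup_eq hFG ⟨_, mono⟩ (by
    simp only [OrderHom.coe_mk]
    rw [← Submodule.span_iUnion]
    unfold Ideal.span
    congr 1
    ext f
    simp [hs, eq_comm])
  have hm : s (N+1) ∈ Ideal.span {s N} := by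
    have : s (N+1) ∈ Ideal.span {f : AddMonoidAlgebra k G | ∃ n : ℕ,
      f = AddMonoidAlgebra.single (x n) 1 - AddMonoidAlgebra.single (-x n) 1} :=
      Ideal.subset_span ⟨N+1, rfl⟩
    rw [hN] at this
    exact this
  obtain ⟨f, hf⟩ := Ideal.mem_span_singleton'.1 hm
  have hs0 : s (N+1) ≠ 0 := by
    intro h
    have := congrArg (fun t => t.coeff (x (N+1))) h
    simp [hs, Finsupp.single_apply, (hne (N+1)).symm] at this
  refine aux_unit (x (N+1)) (hne _) f (mul_right_cancel₀ hs0 ?_)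
  rw [mul_assoc, ← hmul, hf, one_mul]

theorem stmt_6 (k : Type*) [Field k] :
    ¬ (Ideal.span
        {f : AddMonoidAlgebra k
            (AddSubgroup.closure (Set.range fun n : ℕ => (1 : ℚ) / 2 ^ n)) |
          ∃ n : ℕ,
            f = AddMonoidAlgebra.single
                  ⟨(1 : ℚ) / 2 ^ n, AddSubgroup.subset_closure ⟨n, rfl⟩⟩ 1 -
                AddMonoidAlgebra.single
                  (-⟨(1 : ℚ) / 2 ^ n, AddSubgroup.subset_closure ⟨n, rfl⟩⟩) 1}).FG := by
  refine aux_main (fun n : ℕ => (⟨(1 : ℚ) / 2 ^ n, AddSubgroup.subset_closure ⟨n, rfl⟩⟩ :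
    AddSubgroup.closure (Set.range fun n : ℕ => (1 : ℚ) / 2 ^ n))) ?_ ?_
  · intro n
    apply Subtype.ext
    simp only [AddSubgroup.coe_add]
    rw [pow_succ]
    field_simp
    norm_num
  · intro n h
    have h' : (1 : ℚ) / 2 ^ n = -(1 / 2 ^ n) := congrArg Subtype.val h
    have : (0 : ℚ) < 1 / 2 ^ n := by positivity
    linarith
end

section
/- Titchmarsh's convolution theorem (support form): if f and g are locally integrable functions on ℝ with support contained in [0,∞) and their convolution f * g vanishes identically on [0, T], then there exist T_f, T_g ≥ 0 with T_f + T_g ≥ T such that f vanishes a.e. on [0, T_f] and g vanishes a.e. on [0, T_g]. -/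
open MeasureTheory Set

lemma tc_fourier_pow (n : ℕ) (x : AddCircle (1:ℝ)) :
    (fourier (n : ℤ) x : ℂ) = (fourier 1 x : ℂ) ^ n := by
  induction n with
  | zero => simp
  | succ k ih => push_cast; rw [fourier_add, ih, pow_succ]

lemma tc_trig_approx (φ : ℂ → ℝ) (hφ : Continuous φ) (c : ℂ) (R : ℝ) (hR : 0 < R) :
    ∃ q : ℂ → ℂ, Differentiable ℂ q ∧ ∀ z ∈ Metric.sphere c R, |φ z - (q z).re| ≤ 1 := by
  let Z : AddCircle (1:ℝ) → ℂ := fun X => c + R * (fourier 1 X : ℂ)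
  have hZ : Continuous Z := by
    have := (fourier (T := (1:ℝ)) 1).continuous
    fun_prop
  let Φ : C(AddCircle (1:ℝ), ℂ) := ⟨fun X => (φ (Z X) : ℂ), by fun_prop⟩
  have hmem : Φ ∈ closure (Submodule.span ℂ (range (@fourier (1:ℝ))) : Set C(AddCircle (1:ℝ), ℂ)) := by
    rw [← Submodule.topologicalClosure_coe, span_fourier_closure_eq_top]; trivial
  obtain ⟨p, hp, hd⟩ := Metric.mem_closure_iff.1 hmem 1 one_pos
  have key : ∀ q ∈ Submodule.span ℂ (range (@fourier (1:ℝ))), ∃ Q1 Q2 : ℂ → ℂ,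
      Differentiable ℂ Q1 ∧ Differentiable ℂ Q2 ∧
      ∀ X, q X = Q1 (Z X) + (starRingEnd ℂ) (Q2 (Z X)) := by
    intro q hq
    have hZX : ∀ X, (Z X - c) / R = (fourier 1 X : ℂ) := by
      intro X
      have : (R:ℂ) ≠ 0 := by exact_mod_cast hR.ne'
      simp only [Z]; field_simp; ring
    induction hq using Submodule.span_induction with
    | mem x h =>
      obtain ⟨n, rfl⟩ := h
      obtain ⟨m, rfl | rfl⟩ := n.eq_nat_or_neg
      · refine ⟨fun z => ((z - c) / R) ^ m, fun _ => 0, by fun_prop, by fun_prop, fun X => ?_⟩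
        show _ = ((Z X - c) / R) ^ m + (starRingEnd ℂ) 0
        rw [hZX, tc_fourier_pow]; simp
      · refine ⟨fun _ => 0, fun z => ((z - c) / R) ^ m, by fun_prop, by fun_prop, fun X => ?_⟩
        show _ = 0 + (starRingEnd ℂ) (((Z X - c) / R) ^ m)
        rw [hZX, fourier_neg, tc_fourier_pow]; simp
    | zero => exact ⟨fun _ => 0, fun _ => 0, by fun_prop, by fun_prop, by simp⟩
    | add x y _ _ hx hy =>
      obtain ⟨A, B, hA, hB, h⟩ := hx
      obtain ⟨A', B', hA', hB', h'⟩ := hy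
      refine ⟨fun z => A z + A' z, fun z => B z + B' z, by fun_prop, by fun_prop, fun X => ?_⟩
      simp [h, h']; ring
    | smul a x _ hx =>
      obtain ⟨A, B, hA, hB, h⟩ := hx
      refine ⟨fun z => a * A z, fun z => (starRingEnd ℂ) a * B z, by fun_prop, by fun_prop,
        fun X => ?_⟩
      simp [h]; ring
  obtain ⟨Q1, Q2, h1, h2, h3⟩ := key p hp
  refine ⟨fun z => Q1 z + Q2 z, by fun_prop, fun z hz => ?_⟩
  have hz' : z ∈ range (circleMap c R) := by
    rw [range_circleMap, abs_of_pos hR]; exact hz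
  obtain ⟨θ, rfl⟩ := hz'
  have hX : Z ((θ / (2 * Real.pi) : ℝ) : AddCircle (1:ℝ)) = circleMap c R θ := by
    simp only [Z, fourier_coe_apply, circleMap]
    congr 3
    push_cast
    field_simp
  have := ContinuousMap.dist_lt_iff (one_pos) |>.1 hd ((θ / (2 * Real.pi) : ℝ) : AddCircle (1:ℝ))
  rw [h3] at this
  simp only [Φ, ContinuousMap.coe_mk, hX, dist_eq_norm] at this
  have h5 := (Complex.abs_re_le_norm _).trans this.le
  simpa using h5

lemma tc_harnack (q : ℂ → ℂ) (hq : Differentiable ℂ q) (c : ℂ) (R : ℝ) (hR : 0 < R)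
    (h0 : ∀ z ∈ Metric.sphere c R, (q z).re ≤ 0) (w : ℂ) (hw : w ∈ Metric.ball c R) :
    (q w).re ≤ (R - ‖w - c‖) / (R + ‖w - c‖) * (q c).re := by
  have hh : ∀ z, InnerProductSpace.HarmonicAt (fun z => (q z).re) z := fun z =>
    (hq.analyticAt z).harmonicAt_re
  have e1 := InnerProductSpace.HarmonicOnNhd.circleAverage_re_herglotzRieszKernel_smul
    (f := fun z => (q z).re) (c := c) (w := w) (R := R) (fun z _ => hh z) hw
  have e2 := InnerProductSpace.HarmonicOnNhd.circleAverage_eq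
    (f := fun z => (q z).re) (c := c) (R := R) (fun z _ => hh z)
  have hqc := hq.continuous
  rw [← e1, ← e2, ← smul_eq_mul, ← Real.circleAverage_smul]
  have hcs : Continuous fun z => (q z).re := by fun_prop
  apply Real.circleAverage_mono
  · apply ContinuousOn.circleIntegrable'
    have := continuousOn_herglotzRieszKernel_sphere hw
    exact ((Complex.continuous_re.comp_continuousOn this)).smul hcs.continuousOn
  · apply ContinuousOn.circleIntegrable'
    exact (hcs.const_smul _).continuousOn
  · intro z hz
    rw [abs_of_pos hR] at hz
    have := le_re_herglotzRieszKernel hz hw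
    simp only [Pi.smul_apply, Pi.smul_apply', Function.comp, smul_eq_mul, herglotzRieszKernel_def]
    exact mul_le_mul_of_nonpos_right this (h0 z hz)

lemma tc_max (q : ℂ → ℂ) (hq : Differentiable ℂ q) (c : ℂ) (R : ℝ) (hR : 0 < R) (C : ℝ)
    (h0 : ∀ z ∈ Metric.sphere c R, ‖q z‖ ≤ C) (w : ℂ) (hw : w ∈ Metric.ball c R) : ‖q w‖ ≤ C := by
  refine Complex.norm_le_of_forall_mem_frontier_norm_le (U := Metric.ball c R)
    Metric.isBounded_ball hq.diffContOnCl ?_ (subset_closure hw)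
  intro z hz
  rw [frontier_ball c hR.ne'] at hz
  exact h0 z hz

lemma tc_disc_aux (F : ℂ → ℂ) (hF : Differentiable ℂ F) (c : ℂ) (R : ℝ) (hR : 0 < R)
    (ε : ℝ) (hε : 0 < ε) (hε1 : ε ≤ 1) (hb : ∀ z ∈ Metric.sphere c R, ‖F z‖ ≤ 1) :
    ∃ q : ℂ → ℂ, Differentiable ℂ q ∧
      (∀ z ∈ Metric.sphere c R, (q z).re ≤ Real.log (‖F z‖ + ε) + 2) ∧
      ∀ w ∈ Metric.ball c R,
        ‖F w‖ ≤ Real.exp (3 + (R - ‖w - c‖) / (R + ‖w - c‖) * ((q c).re - 3)) := by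
  have hFc := hF.continuous
  have hpos : ∀ z, 0 < ‖F z‖ + ε := fun z => by positivity
  obtain ⟨q, hq, h⟩ := tc_trig_approx (fun z => Real.log (‖F z‖ + ε))
    (by
      apply Continuous.log (by fun_prop)
      exact fun z => (hpos z).ne') c R hR
  have hle : ∀ z ∈ Metric.sphere c R, Real.log (‖F z‖ + ε) ≤ 1 := fun z hz => by
    have h1 := Real.log_le_sub_one_of_pos (hpos z)
    linarith [hb z hz]
  refine ⟨fun z => q z + 1, by fun_prop, fun z hz => ?_, fun w hw => ?_⟩
  · have := abs_le.1 (h z hz)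
    simp; linarith
  · have h1 := tc_harnack (fun z => q z + 1 - 3) (by fun_prop) c R hR (fun z hz => by
      have := abs_le.1 (h z hz)
      have := hle z hz
      simp; linarith) w hw
    have h2 := tc_max (fun z => F z * Complex.exp (-(q z + 1))) (by fun_prop) c R hR 1 (fun z hz => by
      have := abs_le.1 (h z hz)
      rw [norm_mul, Complex.norm_exp]
      have h3 : ‖F z‖ ≤ Real.exp ((q z).re + 1) := by
        calc ‖F z‖ ≤ ‖F z‖ + ε := by linarith
          _ = Real.exp (Real.log (‖F z‖ + ε)) := (Real.exp_log (hpos z)).symm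
          _ ≤ _ := Real.exp_le_exp.2 (by linarith)
      calc _ ≤ Real.exp ((q z).re + 1) * Real.exp (-(q z + 1)).re := by gcongr
        _ = 1 := by rw [← Real.exp_add]; simp) w hw
    rw [norm_mul, Complex.norm_exp] at h2
    have h4 : ‖F w‖ ≤ Real.exp ((q w).re + 1) := by
      have : ‖F w‖ = ‖F w‖ * Real.exp (-(q w + 1)).re * Real.exp ((q w).re + 1) := by
        rw [mul_assoc, ← Real.exp_add]; simp
      rw [this]
      exact mul_le_of_le_one_left (Real.exp_pos _).le h2
    refine h4.trans (Real.exp_le_exp.2 ?_)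
    simp at h1 ⊢
    linarith

lemma tc_disc (F G : ℂ → ℂ) (hF : Differentiable ℂ F) (hG : Differentiable ℂ G) (T : ℝ) (hT : 0 < T)
    (hFb : ∀ z : ℂ, 0 ≤ z.re → ‖F z‖ ≤ 1) (hGb : ∀ z : ℂ, 0 ≤ z.re → ‖G z‖ ≤ 1)
    (hFG : ∀ z : ℂ, 0 ≤ z.re → ‖F z * G z‖ ≤ Real.exp (-T * z.re)) (R : ℝ) (hR : 0 < R) :
    (∀ w ∈ Metric.ball (R : ℂ) R,
      ‖F w‖ ≤ Real.exp (4 - (R - ‖w - R‖) / (R + ‖w - R‖) * (T * R / 2))) ∨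
    (∀ w ∈ Metric.ball (R : ℂ) R,
      ‖G w‖ ≤ Real.exp (4 - (R - ‖w - R‖) / (R + ‖w - R‖) * (T * R / 2))) := by
  have hs : ∀ z ∈ Metric.sphere (R : ℂ) R, 0 ≤ z.re ∧ z.re ≤ 2 * R := by
    intro z hz
    rw [mem_sphere_iff_norm] at hz
    have := (Complex.abs_re_le_norm (z - R)).trans hz.le
    simp [abs_le] at this
    constructor <;> linarith
  set ε := Real.exp (-T * (2 * R)) with hεd
  have hε : 0 < ε := Real.exp_pos _
  have hε1 : ε ≤ 1 := Real.exp_le_one_iff.2 (by nlinarith [mul_pos hT hR])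
  obtain ⟨p, hp, hp1, hp2⟩ := tc_disc_aux F hF R R hR ε hε hε1 (fun z hz => hFb z (hs z hz).1)
  obtain ⟨q, hq, hq1, hq2⟩ := tc_disc_aux G hG R R hR ε hε hε1 (fun z hz => hGb z (hs z hz).1)
  have hc : (p R).re + (q R).re ≤ 7 - T * R := by
    have := tc_max (fun z => Complex.exp (p z + q z + T * z)) (by fun_prop) R R hR (Real.exp 7)
      (fun z hz => by
        rw [Complex.norm_exp]
        apply Real.exp_le_exp.2
        have h1 := hp1 z hz
        have h2 := hq1 z hz
        obtain ⟨hz0, hz2⟩ := hs z hz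
        have h3 : Real.log (‖F z‖ + ε) + Real.log (‖G z‖ + ε) ≤ 3 - T * z.re := by
          rw [← Real.log_mul (by positivity) (by positivity)]
          have h4 : (‖F z‖ + ε) * (‖G z‖ + ε) ≤ 4 * Real.exp (-T * z.re) := by
            have a1 := hFb z hz0
            have a2 := hGb z hz0
            have a3 := hFG z hz0
            rw [norm_mul] at a3
            have a4 : ε ≤ Real.exp (-T * z.re) := Real.exp_le_exp.2 (by nlinarith)
            nlinarith
          calc _ ≤ Real.log (4 * Real.exp (-T * z.re)) := Real.log_le_log (by positivity) h4
            _ = Real.log 4 + -T * z.re := by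
              rw [Real.log_mul (by norm_num) (Real.exp_pos _).ne', Real.log_exp]
            _ ≤ _ := by
              have := Real.log_le_sub_one_of_pos (show (0:ℝ) < 4 by norm_num)
              linarith
        simp
        linarith) R (Metric.mem_ball_self hR)
    rw [Complex.norm_exp] at this
    have := Real.exp_le_exp.1 this
    simp at this
    linarith
  have hfin : ∀ (x : ℝ), x ≤ 7 / 2 - T * R / 2 → ∀ w ∈ Metric.ball (R : ℂ) R,
      3 + (R - ‖w - R‖) / (R + ‖w - R‖) * (x - 3) ≤
        4 - (R - ‖w - R‖) / (R + ‖w - R‖) * (T * R / 2) := by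
    intro x hx w hw
    rw [mem_ball_iff_norm] at hw
    have hn := norm_nonneg (w - R)
    have h0 : 0 ≤ (R - ‖w - R‖) / (R + ‖w - R‖) := div_nonneg (by linarith) (by linarith)
    have h1 : (R - ‖w - R‖) / (R + ‖w - R‖) ≤ 1 := by
      rw [div_le_one (by linarith)]; linarith
    nlinarith
  rcases le_total (p R).re (7 / 2 - T * R / 2) with h | h
  · exact Or.inl fun w hw => (hp2 w hw).trans (Real.exp_le_exp.2 (hfin _ h w hw))
  · exact Or.inr fun w hw => (hq2 w hw).trans (Real.exp_le_exp.2 (hfin _ (by linarith) w hw))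

lemma tc_global_aux (F : ℂ → ℂ) (T : ℝ) (hT : 0 < T)
    (h : ∀ n : ℕ, ∃ m : ℕ, n ≤ m ∧ ∀ w ∈ Metric.ball (((m : ℝ) : ℂ)) (m : ℝ),
      ‖F w‖ ≤ Real.exp (4 - ((m : ℝ) - ‖w - (m : ℝ)‖) / ((m : ℝ) + ‖w - (m : ℝ)‖) * (T * (m : ℝ) / 2)))
    (z : ℂ) (hz : 0 < z.re) : ‖F z‖ ≤ Real.exp (5 - T / 4 * z.re) := by
  obtain ⟨n, hn⟩ := exists_nat_gt (T * ‖z‖ ^ 2 + ‖z‖ ^ 2 / (2 * z.re))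
  obtain ⟨m, hnm, hm⟩ := h n
  have hmn : (n : ℝ) ≤ m := by exact_mod_cast hnm
  set R : ℝ := (m : ℝ) with hRd
  have h1 : 0 ≤ T * ‖z‖ ^ 2 := by positivity
  have h2 : 0 ≤ ‖z‖ ^ 2 / (2 * z.re) := by positivity
  have hR : 0 < R := by
    have : 0 < ‖z‖ := (hz.trans_le (Complex.re_le_norm z))
    have : 0 < T * ‖z‖ ^ 2 := by positivity
    linarith
  have h3 : ‖z‖ ^ 2 < 2 * R * z.re := by
    have : ‖z‖ ^ 2 / (2 * z.re) < R := by linarith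
    rw [div_lt_iff₀ (by positivity)] at this
    linarith
  have h4 : ‖z - R‖ ^ 2 = R ^ 2 - (2 * R * z.re - ‖z‖ ^ 2) := by
    rw [← Complex.normSq_eq_norm_sq, ← Complex.normSq_eq_norm_sq, Complex.normSq_apply,
      Complex.normSq_apply]
    simp; ring
  set r := ‖z - R‖ with hr
  have hr0 : 0 ≤ r := norm_nonneg _
  have hrR : r < R := by nlinarith
  refine (hm z (by rw [mem_ball_iff_norm]; exact hrR)).trans (Real.exp_le_exp.2 ?_)
  have h5 : (2 * R * z.re - ‖z‖ ^ 2) / (4 * R ^ 2) ≤ (R - r) / (R + r) := by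
    have : (R - r) / (R + r) = (2 * R * z.re - ‖z‖ ^ 2) / (R + r) ^ 2 := by
      field_simp; nlinarith
    rw [this]
    apply div_le_div_of_nonneg_left (by linarith) (by positivity)
    nlinarith
  have h6 : (2 * R * z.re - ‖z‖ ^ 2) / (4 * R ^ 2) * (T * R / 2) =
      T / 4 * z.re - T * ‖z‖ ^ 2 / (8 * R) := by
    field_simp; ring
  have h7 : T * ‖z‖ ^ 2 / (8 * R) ≤ 1 := by
    rw [div_le_one (by positivity)]; linarith
  have h8 := mul_le_mul_of_nonneg_right h5 (show 0 ≤ T * R / 2 by positivity)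
  linarith

lemma tc_global (F G : ℂ → ℂ) (hF : Differentiable ℂ F) (hG : Differentiable ℂ G) (T : ℝ)
    (hT : 0 < T)
    (hFb : ∀ z : ℂ, 0 ≤ z.re → ‖F z‖ ≤ 1) (hGb : ∀ z : ℂ, 0 ≤ z.re → ‖G z‖ ≤ 1)
    (hFG : ∀ z : ℂ, 0 ≤ z.re → ‖F z * G z‖ ≤ Real.exp (-T * z.re)) :
    (∀ z : ℂ, 0 < z.re → ‖F z‖ ≤ Real.exp (5 - T / 4 * z.re)) ∨
    (∀ z : ℂ, 0 < z.re → ‖G z‖ ≤ Real.exp (5 - T / 4 * z.re)) := by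
  by_cases h : ∀ n : ℕ, ∃ m : ℕ, n ≤ m ∧ ∀ w ∈ Metric.ball (((m : ℝ) : ℂ)) (m : ℝ),
      ‖F w‖ ≤ Real.exp (4 - ((m : ℝ) - ‖w - (m : ℝ)‖) / ((m : ℝ) + ‖w - (m : ℝ)‖) * (T * (m : ℝ) / 2))
  · exact Or.inl fun z hz => tc_global_aux F T hT h z hz
  · right
    obtain ⟨N, hN⟩ := not_forall.1 h
    refine fun z hz => tc_global_aux G T hT (fun n => ?_) z hz
    refine ⟨max n N + 1, by omega, ?_⟩
    have := tc_disc F G hF hG T hT hFb hGb hFG ((max n N + 1 : ℕ) : ℝ) (by positivity)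
    rcases this with h1 | h1
    · exact absurd ⟨_, by omega, h1⟩ hN
    · exact h1

noncomputable def tcL (h : ℝ → ℂ) (z : ℂ) : ℂ := ∫ t : ℝ, h t * Complex.exp (-(z * t))

lemma tc_int (h : ℝ → ℂ) (hi : Integrable h) (B : ℝ) (hB : ∀ t, t ∉ Icc 0 B → h t = 0) (z : ℂ) :
    Integrable (fun t : ℝ => h t * Complex.exp (-(z * t))) := by
  refine Integrable.mono' (hi.norm.mul_const (Real.exp (‖z‖ * B))) ?_ ?_
  · exact hi.aestronglyMeasurable.mul (by fun_prop : Continuous _).aestronglyMeasurable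
  · refine Filter.Eventually.of_forall fun t => ?_
    by_cases ht : t ∈ Icc 0 B
    · rw [norm_mul, Complex.norm_exp]
      gcongr
      have h1 : -(z * t).re ≤ ‖z * t‖ := (neg_le_abs _).trans (Complex.abs_re_le_norm _)
      rw [norm_mul, Complex.norm_real, Real.norm_eq_abs, abs_of_nonneg ht.1] at h1
      calc (-(z * t)).re ≤ ‖z‖ * t := by simpa using h1
        _ ≤ _ := by gcongr; exact ht.2
    · simp [hB t ht]

lemma tc_diff (h : ℝ → ℂ) (hi : Integrable h) (B : ℝ) (hB : ∀ t, t ∉ Icc 0 B → h t = 0) :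
    Differentiable ℂ (tcL h) := by
  intro z
  have := hasDerivAt_integral_of_dominated_loc_of_deriv_le (μ := volume)
    (F := fun (w : ℂ) (t : ℝ) => h t * Complex.exp (-(w * t)))
    (F' := fun (w : ℂ) (t : ℝ) => h t * (Complex.exp (-(w * t)) * (-t)))
    (bound := fun t => ‖h t‖ * (Real.exp ((‖z‖ + 1) * B) * B)) (x₀ := z)
    (Metric.ball_mem_nhds z one_pos)
    (Filter.Eventually.of_forall fun w => (tc_int h hi B hB w).aestronglyMeasurable)
    (tc_int h hi B hB z)
    (hi.aestronglyMeasurable.mul (by fun_prop : Continuous _).aestronglyMeasurable)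
    (Filter.Eventually.of_forall fun t w hw => ?_)
    (hi.norm.mul_const _)
    (Filter.Eventually.of_forall fun t w hw => ?_)
  · exact this.2.differentiableAt
  · by_cases ht : t ∈ Icc 0 B
    · have hwz : ‖w‖ ≤ ‖z‖ + 1 := by
        rw [mem_ball_iff_norm] at hw
        have := norm_add_le (w - z) z
        rw [sub_add_cancel] at this
        linarith
      rw [norm_mul, norm_mul, Complex.norm_exp, norm_neg, Complex.norm_real, Real.norm_eq_abs,
        abs_of_nonneg ht.1]
      have h1 : -(w * t).re ≤ ‖w * t‖ := (neg_le_abs _).trans (Complex.abs_re_le_norm _)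
      rw [norm_mul, Complex.norm_real, Real.norm_eq_abs, abs_of_nonneg ht.1] at h1
      have h2 : (-(w * t)).re ≤ (‖z‖ + 1) * B :=
        calc (-(w * t)).re ≤ ‖w‖ * t := by simpa using h1
          _ ≤ _ := mul_le_mul hwz ht.2 ht.1 (by positivity)
      gcongr
      · exact ht.1
      · exact ht.2
    · simp [hB t ht]
  · have h1 : HasDerivAt (fun w : ℂ => -(w * t)) (-t) w := by
      simpa using ((hasDerivAt_id w).mul_const (t : ℂ)).fun_neg
    exact (h1.cexp).const_mul (h t)

lemma tc_bound (h : ℝ → ℂ) (hi : Integrable h) (a : ℝ) (z : ℂ)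
    (hz : ∀ᵐ t : ℝ, h t = 0 ∨ -(z.re * t) ≤ -(a * z.re)) :
    ‖tcL h z‖ ≤ Real.exp (-(a * z.re)) * ∫ t, ‖h t‖ := by
  rw [← integral_const_mul]
  refine norm_integral_le_of_norm_le (hi.norm.const_mul _) ?_
  filter_upwards [hz] with t ht
  rcases ht with ht | ht
  · simp [ht]
  · rw [norm_mul, Complex.norm_exp, mul_comm]
    gcongr
    simpa using ht

lemma tc_pw (h : ℝ → ℂ) (hi : Integrable h) (B : ℝ) (hB : ∀ t, t ∉ Icc 0 B → h t = 0)
    (a C : ℝ) (ha : 0 ≤ a) (hC : ∀ z : ℂ, 0 < z.re → ‖tcL h z‖ ≤ C * Real.exp (-(a * z.re))) :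
    ∀ᵐ t : ℝ, t ∈ Icc 0 a → h t = 0 := by
  set h1 := indicator (Iic a) h with h1d
  set h2 := indicator (Ioi a) h with h2d
  have hi1 : Integrable h1 := hi.indicator measurableSet_Iic
  have hi2 : Integrable h2 := hi.indicator measurableSet_Ioi
  have hB1 : ∀ t, t ∉ Icc 0 B → h1 t = 0 := fun t ht => by
    simp [h1, indicator_apply, hB t ht]
  have hB2 : ∀ t, t ∉ Icc 0 B → h2 t = 0 := fun t ht => by
    simp [h2, indicator_apply, hB t ht]
  have hsum : ∀ z, tcL h z = tcL h1 z + tcL h2 z := by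
    intro z
    rw [tcL, tcL, tcL, ← integral_add (tc_int h1 hi1 B hB1 z) (tc_int h2 hi2 B hB2 z)]
    congr 1; ext t
    by_cases ht : t ≤ a
    · simp [h1, h2, indicator_apply, ht, not_lt.2 ht]
    · simp [h1, h2, indicator_apply, ht, not_le.1 ht]
  let P : ℂ → ℂ := fun z => Complex.exp (a * z) * tcL h1 z
  have hPd : Differentiable ℂ P := by
    have := tc_diff h1 hi1 B hB1
    fun_prop
  have hexp : ∀ z : ℂ, ‖Complex.exp (a * z)‖ * Real.exp (-(a * z.re)) = 1 := fun z => by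
    rw [Complex.norm_exp, ← Real.exp_add]; simp
  have hPb : ∀ z, ‖P z‖ ≤ |C| + (∫ t, ‖h1 t‖) + ∫ t, ‖h2 t‖ := by
    intro z
    have p1 : 0 ≤ ∫ t, ‖h1 t‖ := integral_nonneg fun _ => norm_nonneg _
    have p2 : 0 ≤ ∫ t, ‖h2 t‖ := integral_nonneg fun _ => norm_nonneg _
    have p3 := abs_nonneg C
    simp only [P, norm_mul]
    rcases le_or_gt z.re 0 with hz | hz
    · have := tc_bound h1 hi1 a z (Filter.Eventually.of_forall fun t => by
        by_cases ht : t ≤ a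
        · right; nlinarith
        · left; simp [h1, ht])
      calc _ ≤ ‖Complex.exp (a * z)‖ * (Real.exp (-(a * z.re)) * ∫ t, ‖h1 t‖) := by gcongr
        _ = ∫ t, ‖h1 t‖ := by rw [← mul_assoc, hexp, one_mul]
        _ ≤ _ := by linarith
    · have := tc_bound h2 hi2 a z (Filter.Eventually.of_forall fun t => by
        by_cases ht : t ≤ a
        · left; simp [h2, ht]
        · right; nlinarith)
      have e : tcL h1 z = tcL h z - tcL h2 z := by rw [hsum]; ring
      have q1 : ‖tcL h1 z‖ ≤ Real.exp (-(a * z.re)) * (C + ∫ t, ‖h2 t‖) := by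
        rw [e]
        refine (norm_sub_le _ _).trans ?_
        have := hC z hz
        linarith
      calc _ ≤ ‖Complex.exp (a * z)‖ * (Real.exp (-(a * z.re)) * (C + ∫ t, ‖h2 t‖)) := by gcongr
        _ = C + ∫ t, ‖h2 t‖ := by rw [← mul_assoc, hexp, one_mul]
        _ ≤ _ := by linarith [le_abs_self C]
  have hconst : ∀ z, P z = P 0 := fun z => by
    apply hPd.apply_eq_apply_of_bounded
    rw [isBounded_iff_forall_norm_le]
    exact ⟨_, by rintro _ ⟨z, rfl⟩; exact hPb z⟩
  -- moments
  have hmom : ∀ n : ℕ, ∫ t, ((Real.exp (a - t) ^ n : ℝ) : ℂ) * h1 t = P 0 := by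
    intro n
    rw [← hconst n]
    simp only [P, tcL]
    rw [← integral_const_mul]
    congr 1; ext t
    rw [← Real.exp_nat_mul, mul_left_comm, ← Complex.exp_add, mul_comm]
    congr 1
    push_cast
    congr 1; ring
  have hint : ∀ p : Polynomial ℝ, Integrable (fun t => ((p.eval (Real.exp (a - t)) : ℝ) : ℂ) * h1 t) ∧
      ∫ t, ((p.eval (Real.exp (a - t)) : ℝ) : ℂ) * h1 t = (p.eval 1 : ℝ) * P 0 := by
    intro p
    induction p using Polynomial.induction_on' with
    | add p q hp hq =>
      simp only [Polynomial.eval_add, Complex.ofReal_add, add_mul]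
      exact ⟨hp.1.add hq.1, by rw [integral_add hp.1 hq.1, hp.2, hq.2]⟩
    | monomial n r =>
      simp only [Polynomial.eval_monomial, Complex.ofReal_mul, mul_assoc]
      refine ⟨Integrable.const_mul ?_ _, ?_⟩
      · have := (tc_int h1 hi1 B hB1 n).const_mul (Complex.exp (a * n))
        refine this.congr (Filter.Eventually.of_forall fun t => ?_)
        beta_reduce
        rw [← Real.exp_nat_mul, mul_left_comm, ← Complex.exp_add, mul_comm]
        congr 1
        push_cast
        congr 1; ring
      · rw [integral_const_mul, hmom]; simp
  have main : ∀ᵐ t : ℝ, t ∈ Ioo 0 a → h1 t = 0 := by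
    apply isOpen_Ioo.ae_eq_zero_of_integral_contDiff_smul_eq_zero
      (hi1.locallyIntegrable.locallyIntegrableOn _)
    intro φ hφ _ hsupp
    have hφc := hφ.continuous
    have hφ0 : ∀ t, t ∉ Ioo 0 a → φ t = 0 := fun t ht =>
      image_eq_zero_of_notMem_tsupport fun h => ht (hsupp h)
    have hφi : Integrable (fun t => φ t • h1 t) := by
      obtain ⟨M, hM⟩ := hφc.bounded_above_of_compact_support (by assumption)
      exact hi1.bdd_smul M hφc.aestronglyMeasurable (Filter.Eventually.of_forall hM)
    set K := ‖P 0‖ + ∫ t, ‖h1 t‖ with hK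
    have p1 : 0 ≤ ∫ t, ‖h1 t‖ := integral_nonneg fun _ => norm_nonneg _
    have hbd : ∀ ε > 0, ‖∫ t, φ t • h1 t‖ ≤ ε * K := by
      intro ε hε
      obtain ⟨p, hp⟩ := exists_polynomial_near_of_continuousOn 1 (Real.exp a)
        (fun s => φ (a - Real.log s)) (by
          apply hφc.comp_continuousOn
          apply continuousOn_const.sub
          apply Real.continuousOn_log.mono
          intro s hs
          have := hs.1
          simp; linarith) ε hε
      have q1 : |p.eval 1| ≤ ε := by
        have := hp 1 ⟨le_rfl, Real.one_le_exp ha⟩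
        simp [hφ0 a (by simp)] at this
        exact this.le
      have q2 : ‖∫ t, (φ t • h1 t - ((p.eval (Real.exp (a - t)) : ℝ) : ℂ) * h1 t)‖
          ≤ ε * ∫ t, ‖h1 t‖ := by
        rw [← integral_const_mul]
        refine norm_integral_le_of_norm_le (hi1.norm.const_mul _)
          (Filter.Eventually.of_forall fun t => ?_)
        rw [Complex.real_smul, ← sub_mul, norm_mul]
        by_cases ht : t ∈ Icc 0 a
        · gcongr
          rw [← Complex.ofReal_sub, Complex.norm_real, Real.norm_eq_abs, abs_sub_comm]
          have := hp (Real.exp (a - t)) ⟨Real.one_le_exp (by linarith [ht.2]),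
            Real.exp_le_exp.2 (by linarith [ht.1])⟩
          simp at this
          exact this.le
        · have : h1 t = 0 := by
            by_cases hta : t ≤ a
            · exact hB1 t fun h' => ht ⟨h'.1, hta⟩
            · simp [h1, hta]
          simp [this]
      rw [integral_sub hφi (hint p).1, (hint p).2] at q2
      have q3 : ‖((p.eval 1 : ℝ) : ℂ) * P 0‖ ≤ ε * ‖P 0‖ := by
        rw [norm_mul, Complex.norm_real]
        gcongr
        exact q1
      have q4 := norm_add_le (∫ t, φ t • h1 t - 0) 0
      have q5 := norm_le_norm_sub_add (∫ t, φ t • h1 t) (((p.eval 1 : ℝ) : ℂ) * P 0)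
      rw [hK, mul_add]; linarith
    have hK0 : 0 ≤ K := by positivity
    rw [← norm_le_zero_iff]
    refine le_of_forall_pos_le_add fun ε hε => ?_
    have := hbd (ε / (K + 1)) (by positivity)
    refine this.trans ?_
    rw [zero_add, div_mul_eq_mul_div, div_le_iff₀ (by positivity)]
    nlinarith
  have n0 : ∀ᵐ t : ℝ, t ≠ 0 := by simp [ae_iff]
  have na : ∀ᵐ t : ℝ, t ≠ a := by simp [ae_iff]
  filter_upwards [main, n0, na] with t ht h0 hta hI
  have := ht ⟨lt_of_le_of_ne hI.1 (Ne.symm h0), lt_of_le_of_ne hI.2 hta⟩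
  simpa [h1, hI.2] using this

lemma tc_ae_Icc_sup (f : ℝ → ℂ) (T : ℝ) (hT : 0 < T) :
    ∃ a, 0 ≤ a ∧ a ≤ T ∧ (∀ᵐ x : ℝ, x ∈ Icc (0 : ℝ) a → f x = 0) ∧
      ∀ b, b ≤ T → (∀ᵐ x : ℝ, x ∈ Icc (0 : ℝ) b → f x = 0) → b ≤ a := by
  set S : Set ℝ := {b | b ≤ T ∧ ∀ᵐ x : ℝ, x ∈ Icc (0 : ℝ) b → f x = 0} with hS
  have hne : (0 : ℝ) ∈ S := by
    refine ⟨hT.le, ?_⟩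
    have n0 : ∀ᵐ t : ℝ, t ≠ 0 := by simp [ae_iff]
    filter_upwards [n0] with t ht hI
    simp at hI; exact absurd hI ht
  have hbdd : BddAbove S := ⟨T, fun b hb => hb.1⟩
  refine ⟨sSup S, le_csSup hbdd hne, csSup_le ⟨0, hne⟩ fun b hb => hb.1, ?_,
    fun b hb h => le_csSup hbdd ⟨hb, h⟩⟩
  have h1 : ∀ n : ℕ, ∀ᵐ x : ℝ, x ∈ Icc (0 : ℝ) (sSup S - 1 / (n + 1)) → f x = 0 := by
    intro n
    obtain ⟨b, hb, hlt⟩ := exists_lt_of_lt_csSup ⟨0, hne⟩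
      (show sSup S - 1 / ((n : ℝ) + 1) < sSup S by
        have : 0 < 1 / ((n : ℝ) + 1) := by positivity
        linarith)
    filter_upwards [hb.2] with x hx hI
    exact hx ⟨hI.1, hI.2.trans hlt.le⟩
  have na : ∀ᵐ t : ℝ, t ≠ sSup S := by simp [ae_iff]
  filter_upwards [ae_all_iff.2 h1, na] with x hx hxa hI
  have hlt : x < sSup S := lt_of_le_of_ne hI.2 hxa
  obtain ⟨n, hn⟩ := exists_nat_one_div_lt (sub_pos.2 hlt)
  exact hx n ⟨hI.1, by linarith⟩

lemma tc_trunc (f : ℝ → ℂ) (hf : LocallyIntegrable f volume) (T : ℝ) :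
    Integrable (indicator (Icc 0 T) f) :=
  (integrable_indicator_iff measurableSet_Icc).2 (hf.integrableOn_isCompact isCompact_Icc)

lemma tc_conv (f g : ℝ → ℂ) (hf : Integrable f) (hg : Integrable g) (T : ℝ)
    (hfB : ∀ t, t ∉ Icc 0 T → f t = 0) (hgB : ∀ t, t ∉ Icc 0 T → g t = 0) (z : ℂ) :
    tcL f z * tcL g z = tcL (convolution f g (ContinuousLinearMap.mul ℝ ℂ) volume) z := by
  have := integral_convolution (μ := volume) (ν := volume) (ContinuousLinearMap.mul ℝ ℂ)
    (tc_int f hf T hfB z) (tc_int g hg T hgB z)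
  rw [ContinuousLinearMap.mul_apply'] at this
  rw [tcL, tcL, ← this, tcL]
  congr 1; ext t
  simp only [convolution, ContinuousLinearMap.mul_apply']
  rw [← integral_mul_const]
  congr 1; ext s
  have : Complex.exp (-(z * t)) = Complex.exp (-(z * s)) * Complex.exp (-(z * ((t - s : ℝ) : ℂ))) := by
    rw [← Complex.exp_add]; congr 1; push_cast; ring
  rw [this]; ring

theorem stmt_14 (f g : ℝ → ℂ)
    (hf : LocallyIntegrable f volume) (hg : LocallyIntegrable g volume)
    (hfs : Function.support f ⊆ Ici (0 : ℝ))
    (hgs : Function.support g ⊆ Ici (0 : ℝ))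
    (T : ℝ) (hT : 0 < T)
    (hconv : ∀ t ∈ Icc (0 : ℝ) T,
      convolution f g (ContinuousLinearMap.mul ℝ ℂ) volume t = 0) :
    ∃ Tf Tg : ℝ, 0 ≤ Tf ∧ 0 ≤ Tg ∧ T ≤ Tf + Tg ∧
      (∀ᵐ x ∂volume, x ∈ Icc (0 : ℝ) Tf → f x = 0) ∧
      (∀ᵐ x ∂volume, x ∈ Icc (0 : ℝ) Tg → g x = 0) := by
  obtain ⟨a, ha0, haT, haf, hamax⟩ := tc_ae_Icc_sup f T hT
  obtain ⟨b, hb0, hbT, hbg, hbmax⟩ := tc_ae_Icc_sup g T hT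
  refine ⟨a, b, ha0, hb0, ?_, haf, hbg⟩
  by_contra hlt
  push Not at hlt
  have hf0 : ∀ t < 0, f t = 0 := fun t ht => by
    by_contra h; exact absurd (hfs h) (not_le.2 ht)
  have hg0 : ∀ t < 0, g t = 0 := fun t ht => by
    by_contra h; exact absurd (hgs h) (not_le.2 ht)
  set f1 := indicator (Icc 0 T) f with hf1
  set g1 := indicator (Icc 0 T) g with hg1
  have hfi : Integrable f1 := tc_trunc f hf T
  have hgi : Integrable g1 := tc_trunc g hg T
  have hfB : ∀ t, t ∉ Icc 0 T → f1 t = 0 := fun t ht => indicator_of_notMem ht _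
  have hgB : ∀ t, t ∉ Icc 0 T → g1 t = 0 := fun t ht => indicator_of_notMem ht _
  set k := convolution f1 g1 (ContinuousLinearMap.mul ℝ ℂ) volume with hk
  have hki : Integrable k := hfi.integrable_convolution _ hgi
  have hk0 : ∀ t ≤ T, k t = 0 := by
    intro t ht
    rcases lt_or_ge t 0 with h | h
    · simp only [hk, convolution]
      rw [← integral_zero ℝ ℂ]
      congr 1; ext s
      rw [ContinuousLinearMap.mul_apply']
      by_cases hs : 0 ≤ s
      · rw [hgB (t - s) (fun hh => by linarith [hh.1]), mul_zero]
      · rw [hfB s (fun hh => hs hh.1), zero_mul]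
    · rw [← hconv t ⟨h, ht⟩]
      simp only [hk, convolution]
      congr 1; ext s
      rw [ContinuousLinearMap.mul_apply', ContinuousLinearMap.mul_apply']
      by_cases hs : 0 ≤ s
      · by_cases hst : s ≤ t
        · rw [hf1, hg1, indicator_of_mem (show s ∈ Icc 0 T from ⟨hs, hst.trans ht⟩),
            indicator_of_mem (show t - s ∈ Icc 0 T from ⟨by linarith, by linarith⟩)]
        · rw [hgB (t - s) (fun hh => by linarith [hh.1]), hg0 (t - s) (by linarith)]
          simp
      · rw [hfB s (fun hh => hs hh.1), hf0 s (by linarith)]; simp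
  set Cf := ∫ t, ‖f1 t‖
  set Cg := ∫ t, ‖g1 t‖
  set Ck := ∫ t, ‖k t‖
  have pf : 0 ≤ Cf := integral_nonneg fun _ => norm_nonneg _
  have pg : 0 ≤ Cg := integral_nonneg fun _ => norm_nonneg _
  have pk : 0 ≤ Ck := integral_nonneg fun _ => norm_nonneg _
  have bf : ∀ z : ℂ, 0 ≤ z.re → ‖tcL f1 z‖ ≤ Real.exp (-(a * z.re)) * Cf := fun z hz => by
    refine tc_bound f1 hfi a z ?_
    filter_upwards [haf] with t ht
    by_cases h : a ≤ t
    · right; nlinarith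
    · left
      by_cases h0 : 0 ≤ t
      · simp [hf1, indicator_apply, ht ⟨h0, by linarith⟩]
      · exact hfB t fun hh => h0 hh.1
  have bg : ∀ z : ℂ, 0 ≤ z.re → ‖tcL g1 z‖ ≤ Real.exp (-(b * z.re)) * Cg := fun z hz => by
    refine tc_bound g1 hgi b z ?_
    filter_upwards [hbg] with t ht
    by_cases h : b ≤ t
    · right; nlinarith
    · left
      by_cases h0 : 0 ≤ t
      · simp [hg1, indicator_apply, ht ⟨h0, by linarith⟩]
      · exact hgB t fun hh => h0 hh.1
  have bk : ∀ z : ℂ, 0 ≤ z.re → ‖tcL f1 z * tcL g1 z‖ ≤ Real.exp (-(T * z.re)) * Ck :=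
    fun z hz => by
      rw [tc_conv f1 g1 hfi hgi T hfB hgB z]
      refine tc_bound k hki T z (Filter.Eventually.of_forall fun t => ?_)
      by_cases h : t ≤ T
      · left; exact hk0 t h
      · right; nlinarith
  have df := tc_diff f1 hfi T hfB
  have dg := tc_diff g1 hgi T hgB
  set A : ℝ := Cf + Ck + 1 with hA
  set B : ℝ := Cg + 1 with hB
  have pA : 0 < A := by positivity
  have pB : 0 < B := by positivity
  set T' := T - a - b with hT'
  have pT' : 0 < T' := by linarith
  have hnorm : ∀ (c D : ℝ) (_ : 0 < D) (h : ℝ → ℂ) (z : ℂ),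
      ‖Complex.exp (c * z) * tcL h z / D‖ = Real.exp (c * z.re) * ‖tcL h z‖ / D := by
    intro c D hD h z
    rw [norm_div, norm_mul, Complex.norm_exp, Complex.norm_real, Real.norm_eq_abs, abs_of_pos hD]
    simp
  have hback : ∀ (c D : ℝ) (_ : 0 < D) (h : ℝ → ℂ),
      (∀ z : ℂ, 0 < z.re → ‖Complex.exp (c * z) * tcL h z / D‖ ≤ Real.exp (5 - T' / 4 * z.re)) →
      ∀ z : ℂ, 0 < z.re → ‖tcL h z‖ ≤ D * Real.exp 5 * Real.exp (-((c + T' / 4) * z.re)) := by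
    intro c D hD h hh z hz
    have h1 := hh z hz
    rw [hnorm c D hD, div_le_iff₀ hD] at h1
    have h2 : ‖tcL h z‖ = Real.exp (-(c * z.re)) * (Real.exp (c * z.re) * ‖tcL h z‖) := by
      rw [← mul_assoc, ← Real.exp_add]; simp
    rw [h2]
    calc _ ≤ Real.exp (-(c * z.re)) * (Real.exp (5 - T' / 4 * z.re) * D) := by gcongr
      _ = D * (Real.exp (-(c * z.re)) * Real.exp (5 - T' / 4 * z.re)) := by ring
      _ = D * (Real.exp 5 * Real.exp (-((c + T' / 4) * z.re))) := by
        rw [← Real.exp_add, ← Real.exp_add]; congr 2; ring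
      _ = _ := by ring
  rcases tc_global (fun z => Complex.exp (a * z) * tcL f1 z / A)
      (fun z => Complex.exp (b * z) * tcL g1 z / B) (by fun_prop) (by fun_prop) T' pT'
      (fun z hz => by
        rw [hnorm a A pA, div_le_one pA]
        calc _ ≤ Real.exp (a * z.re) * (Real.exp (-(a * z.re)) * Cf) := by gcongr; exact bf z hz
          _ = Cf := by rw [← mul_assoc, ← Real.exp_add]; simp
          _ ≤ A := by linarith)
      (fun z hz => by
        rw [hnorm b B pB, div_le_one pB]
        calc _ ≤ Real.exp (b * z.re) * (Real.exp (-(b * z.re)) * Cg) := by gcongr; exact bg z hz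
          _ = Cg := by rw [← mul_assoc, ← Real.exp_add]; simp
          _ ≤ B := by linarith)
      (fun z hz => by
        rw [norm_mul, hnorm a A pA, hnorm b B pB, div_mul_div_comm, div_le_iff₀ (by positivity)]
        have h1 := bk z hz
        rw [norm_mul] at h1
        calc _ = Real.exp (a * z.re) * Real.exp (b * z.re) * (‖tcL f1 z‖ * ‖tcL g1 z‖) := by ring
          _ ≤ Real.exp (a * z.re) * Real.exp (b * z.re) * (Real.exp (-(T * z.re)) * Ck) := by gcongr
          _ = Real.exp (-T' * z.re) * Ck := by
            rw [← mul_assoc, ← Real.exp_add, ← Real.exp_add]; congr 2; rw [hT']; ring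
          _ ≤ _ := by
            gcongr
            nlinarith) with h | h
  · have h1 := tc_pw f1 hfi T hfB (a + T' / 4) (A * Real.exp 5) (by positivity)
      (hback a A pA f1 h)
    have h2 : a + T' / 4 ≤ T := by linarith
    have := hamax (a + T' / 4) h2 (by
      filter_upwards [h1] with t ht hI
      have h3 := ht hI
      rwa [hf1, indicator_of_mem (show t ∈ Icc 0 T from ⟨hI.1, hI.2.trans h2⟩)] at h3)
    linarith
  · have h1 := tc_pw g1 hgi T hgB (b + T' / 4) (B * Real.exp 5) (by positivity)
      (hback b B pB g1 h)
    have h2 : b + T' / 4 ≤ T := by linarith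
    have := hbmax (b + T' / 4) h2 (by
      filter_upwards [h1] with t ht hI
      have h3 := ht hI
      rwa [hg1, indicator_of_mem (show t ∈ Icc 0 T from ⟨hI.1, hI.2.trans h2⟩)] at h3)
    linarith
end

section
/- The convolution ring of locally integrable complex-valued functions on ℝ with left-bounded support has no zero divisors: if f * g = 0 (a.e.) then f = 0 a.e. or g = 0 a.e. -/
open MeasureTheory Set

structure TGood (R : ℝ) (h : ℝ → ℂ) : Prop where
  int : Integrable h volume
  supp : ∀ t, t ∉ Icc 0 R → h t = 0

noncomputable def TLap (h : ℝ → ℂ) (z : ℂ) : ℂ := ∫ t : ℝ, Complex.exp (-z * t) * h t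

lemma TGood.mul_cont {R : ℝ} {h : ℝ → ℂ} (hh : TGood R h) {φ : ℝ → ℂ} (hφ : Continuous φ) :
    TGood R (fun t => φ t * h t) := by
  refine ⟨?_, fun t ht => by simp [hh.supp t ht]⟩
  obtain ⟨C, hC⟩ := (isCompact_Icc (a := (0:ℝ)) (b := R)).exists_bound_of_continuousOn hφ.continuousOn
  refine Integrable.mono' (hh.int.norm.const_mul C)
    (hφ.aestronglyMeasurable.mul hh.int.aestronglyMeasurable) (Filter.Eventually.of_forall fun t => ?_)
  by_cases ht : t ∈ Icc 0 R
  · rw [norm_mul]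
    exact mul_le_mul_of_nonneg_right (hC t ht) (norm_nonneg _)
  · simp [hh.supp t ht]

lemma TGood.exp {R : ℝ} {h : ℝ → ℂ} (hh : TGood R h) (z : ℂ) :
    TGood R (fun t : ℝ => Complex.exp (-z * t) * h t) :=
  hh.mul_cont (by fun_prop)

lemma TGood.id {R : ℝ} {h : ℝ → ℂ} (hh : TGood R h) :
    TGood R (fun t : ℝ => (t : ℂ) * h t) :=
  hh.mul_cont (by fun_prop)

lemma TGood.moment {R : ℝ} {h : ℝ → ℂ} (hh : TGood R h)
    (H : ∀ n : ℕ, ∫ t : ℝ, (t : ℂ) ^ n * h t = 0) : ∀ᵐ t, h t = 0 := by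
  have hpoly : ∀ p : Polynomial ℝ, ∫ t : ℝ, ((p.eval t : ℝ) : ℂ) * h t = 0 := by
    intro p
    induction p using Polynomial.induction_on' with
    | add p q hp hq =>
      simp only [Polynomial.eval_add, Complex.ofReal_add, add_mul]
      rw [integral_add, hp, hq, add_zero]
      · exact (hh.mul_cont (by fun_prop)).int
      · exact (hh.mul_cont (by fun_prop)).int
    | monomial n a =>
      simp only [Polynomial.eval_monomial, Complex.ofReal_mul, Complex.ofReal_pow, mul_assoc]
      rw [integral_const_mul, H, mul_zero]
  apply ae_eq_zero_of_integral_contDiff_smul_eq_zero hh.int.locallyIntegrable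
  intro g hg _
  have hgc : Continuous g := hg.continuous
  simp only [Complex.real_smul]
  have key : ∀ ε > 0, ‖∫ t : ℝ, ((g t : ℝ) : ℂ) * h t‖ ≤ ε * ∫ t, ‖h t‖ := by
    intro ε hε
    obtain ⟨p, hp⟩ := exists_polynomial_near_of_continuousOn 0 R g hgc.continuousOn ε hε
    have e : ∫ t : ℝ, ((g t : ℝ) : ℂ) * h t
        = ∫ t : ℝ, (((g t : ℝ) : ℂ) - ((p.eval t : ℝ) : ℂ)) * h t := by
      simp only [sub_mul]
      rw [integral_sub, hpoly, sub_zero]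
      · exact (hh.mul_cont (by fun_prop)).int
      · exact (hh.mul_cont (by fun_prop)).int
    rw [e, ← integral_const_mul]
    refine norm_integral_le_of_norm_le (hh.int.norm.const_mul ε) (Filter.Eventually.of_forall fun t => ?_)
    by_cases ht : t ∈ Icc 0 R
    · rw [norm_mul]
      refine mul_le_mul_of_nonneg_right ?_ (norm_nonneg _)
      rw [← Complex.ofReal_sub, Complex.norm_real, Real.norm_eq_abs, abs_sub_comm]
      exact (hp t ht).le
    · simp [hh.supp t ht]
  have h0 : 0 ≤ ∫ t, ‖h t‖ := integral_nonneg fun t => norm_nonneg _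
  rw [← norm_le_zero_iff]
  refine le_of_forall_pos_le_add fun δ hδ => ?_
  have := key (δ / (1 + ∫ t, ‖h t‖)) (by positivity)
  refine this.trans ?_
  rw [zero_add, div_mul_eq_mul_div, div_le_iff₀ (by positivity)]
  nlinarith

lemma TGood.hasDeriv {R : ℝ} {h : ℝ → ℂ} (hh : TGood R h) (z : ℂ) :
    HasDerivAt (TLap h) (- TLap (fun t : ℝ => (t : ℂ) * h t) z) z := by
  have hR : ∀ t ∈ Icc (0:ℝ) R, ∀ w ∈ Metric.ball z 1,
      ‖Complex.exp (-w * t)‖ ≤ Real.exp ((‖z‖ + 1) * R) := by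
    intro t ht w hw
    rw [Complex.norm_exp]
    apply Real.exp_le_exp.2
    have h1 : (-w * (t:ℂ)).re = -w.re * t := by simp
    rw [h1]
    have h2 : ‖w‖ ≤ ‖z‖ + 1 := by
      have := norm_sub_norm_le w z
      rw [Metric.mem_ball, dist_eq_norm] at hw
      linarith
    have h3 : -w.re ≤ ‖w‖ := by
      have := Complex.abs_re_le_norm w
      have := neg_abs_le w.re
      linarith
    have h4 : -w.re ≤ ‖z‖ + 1 := by linarith
    exact (mul_le_mul_of_nonneg_right h4 ht.1).trans
      (mul_le_mul_of_nonneg_left ht.2 (by positivity))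
  have := (hasDerivAt_integral_of_dominated_loc_of_deriv_le (μ := volume) (𝕜 := ℂ)
    (F := fun z (t:ℝ) => Complex.exp (-z * t) * h t)
    (F' := fun z (t:ℝ) => -(Complex.exp (-z * t) * ((t:ℂ) * h t)))
    (bound := fun t : ℝ => Real.exp ((‖z‖ + 1) * R) * ‖(t:ℂ) * h t‖)
    (x₀ := z)
    (Metric.ball_mem_nhds z one_pos)
    (Filter.Eventually.of_forall fun w => (hh.exp w).int.aestronglyMeasurable)
    (hh.exp z).int
    (hh.id.exp z).int.neg.aestronglyMeasurable
    (Filter.Eventually.of_forall fun t w hw => ?_)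
    (hh.id.int.norm.const_mul _)
    (Filter.Eventually.of_forall fun t w hw => ?_)).2
  · rw [integral_neg] at this
    exact this
  · by_cases ht : t ∈ Icc 0 R
    · rw [norm_neg, norm_mul]
      exact mul_le_mul_of_nonneg_right (hR t ht w hw) (norm_nonneg _)
    · simp [hh.supp t ht]
  · have h1 : HasDerivAt (fun w : ℂ => -w * (t:ℂ)) (-1 * (t:ℂ)) w :=
      ((hasDerivAt_id w).neg).mul_const _
    convert! (h1.cexp).mul_const (h t) using 1
    ring

lemma TGood.lap_inj {R : ℝ} {h : ℝ → ℂ} (hh : TGood R h) (H : ∀ z, TLap h z = 0) :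
    ∀ᵐ t, h t = 0 := by
  have key : ∀ n : ℕ, TGood R (fun t : ℝ => (t:ℂ)^n * h t) ∧
      ∀ z, TLap (fun t : ℝ => (t:ℂ)^n * h t) z = 0 := by
    intro n
    induction n with
    | zero => simpa using ⟨hh, H⟩
    | succ n ih =>
      obtain ⟨h1, h2⟩ := ih
      have e : (fun t : ℝ => (t:ℂ)^(n+1) * h t) = fun t : ℝ => (t:ℂ) * ((t:ℂ)^n * h t) := by
        ext t; ring
      rw [e]
      refine ⟨h1.id, fun z => ?_⟩
      have h3 := h1.hasDeriv z
      have h4 : TLap (fun t : ℝ => (t:ℂ)^n * h t) = fun _ => 0 := funext h2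
      rw [h4] at h3
      simpa using h3.unique (hasDerivAt_const z 0)
  apply hh.moment
  intro n
  simpa [TLap] using (key n).2 0

/-- bound in the right half plane -/
lemma TLap_bound_right {h : ℝ → ℂ} (hh : Integrable h) (a : ℝ)
    (hs : ∀ᵐ t, t < a → h t = 0) (z : ℂ) (hz : 0 ≤ z.re) :
    ‖TLap h z‖ ≤ Real.exp (-a * z.re) * ∫ t, ‖h t‖ := by
  rw [← integral_const_mul]
  refine norm_integral_le_of_norm_le (hh.norm.const_mul _) ?_
  filter_upwards [hs] with t ht
  by_cases h1 : t < a
  · simp [ht h1]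
  · rw [norm_mul, Complex.norm_exp]
    refine mul_le_mul_of_nonneg_right (Real.exp_le_exp.2 ?_) (norm_nonneg _)
    simp
    nlinarith

lemma TLap_bound_left {h : ℝ → ℂ} (hh : Integrable h) (a : ℝ)
    (hs : ∀ᵐ t, a < t → h t = 0) (z : ℂ) (hz : z.re ≤ 0) :
    ‖TLap h z‖ ≤ Real.exp (-a * z.re) * ∫ t, ‖h t‖ := by
  rw [← integral_const_mul]
  refine norm_integral_le_of_norm_le (hh.norm.const_mul _) ?_
  filter_upwards [hs] with t ht
  by_cases h1 : a < t
  · simp [ht h1]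
  · rw [norm_mul, Complex.norm_exp]
    refine mul_le_mul_of_nonneg_right (Real.exp_le_exp.2 ?_) (norm_nonneg _)
    simp
    nlinarith

lemma TGood.key {R : ℝ} {h : ℝ → ℂ} (hh : TGood R h) (a C : ℝ) (ha : 0 ≤ a)
    (H : ∀ x : ℝ, 0 ≤ x → ‖TLap h x‖ ≤ C * Real.exp (-a * x)) :
    ∀ᵐ t, t < a → h t = 0 := by
  classical
  set k : ℝ → ℂ := (Iio a).indicator h with hk
  set l : ℝ → ℂ := (Ici a).indicator h with hl
  have gk : TGood R k := ⟨hh.int.indicator measurableSet_Iio, fun t ht => by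
    simp [hk, indicator, hh.supp t ht]⟩
  have gl : TGood R l := ⟨hh.int.indicator measurableSet_Ici, fun t ht => by
    simp [hl, indicator, hh.supp t ht]⟩
  have hkl : ∀ z, TLap h z = TLap k z + TLap l z := by
    intro z
    unfold TLap
    rw [← integral_add (gk.exp z).int (gl.exp z).int]
    congr 1; ext t
    rw [← mul_add]
    congr 1
    by_cases ht : t < a
    · simp [hk, hl, indicator, ht, not_le.2 ht]
    · simp [hk, hl, indicator, ht, not_lt.1 ht]
  set M := ∫ t, ‖k t‖ with hM
  have hM0 : 0 ≤ M := integral_nonneg fun t => norm_nonneg _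
  set E : ℂ → ℂ := fun z => Complex.exp (a * z) * TLap k z with hE
  have hEn : ∀ z, ‖E z‖ = Real.exp (a * z.re) * ‖TLap k z‖ := by
    intro z; simp [hE, Complex.norm_exp]
  have hEd : Differentiable ℂ E := by
    intro z
    exact DifferentiableAt.mul (by fun_prop) (gk.hasDeriv z).differentiableAt
  have hleft : ∀ z : ℂ, z.re ≤ 0 → ‖E z‖ ≤ M := by
    intro z hz
    rw [hEn]
    have := TLap_bound_left gk.int a (Filter.Eventually.of_forall fun t ht => by
      simp [hk, indicator, not_lt.2 ht.le]) z hz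
    calc _ ≤ Real.exp (a * z.re) * (Real.exp (-a * z.re) * M) := by gcongr
      _ = M := by rw [← mul_assoc, ← Real.exp_add]; simp
  have hright : ∀ z : ℂ, 0 ≤ z.re → ‖E z‖ ≤ M := by
    intro z hz
    refine PhragmenLindelof.right_half_plane_of_bounded_on_real hEd.diffContOnCl
      ⟨1, by norm_num, a, ?_⟩ ?_ (fun x => hleft _ (by simp)) hz
    · refine Asymptotics.IsBigO.of_bound M ?_
      refine Filter.eventually_inf_principal.2 (Filter.Eventually.of_forall fun w hw => ?_)
      have hw' : 0 ≤ w.re := le_of_lt hw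
      have := TLap_bound_right gk.int 0 (Filter.Eventually.of_forall fun t ht => 
        gk.supp t (fun h => absurd h.1 (not_le.2 ht))) w hw'
      simp only [neg_zero, zero_mul, Real.exp_zero, one_mul] at this
      rw [hEn, Real.rpow_one, Real.norm_of_nonneg (Real.exp_nonneg _), mul_comm]
      refine mul_le_mul this (Real.exp_le_exp.2 ?_) (Real.exp_nonneg _) hM0
      exact mul_le_mul_of_nonneg_left ((le_abs_self _).trans (Complex.abs_re_le_norm w)) ha
    · refine Filter.isBoundedUnder_of_eventually_le (a := C + ∫ t, ‖l t‖) ?_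
      filter_upwards [Filter.eventually_ge_atTop (0:ℝ)] with x hx
      have h1 := H x hx
      have h2 := TLap_bound_right gl.int a (Filter.Eventually.of_forall fun t ht => by
        simp [hl, indicator, not_le.2 ht]) x (by simpa using hx)
      have h3 : ‖TLap k x‖ ≤ (C + ∫ t, ‖l t‖) * Real.exp (-a * x) := by
        have : TLap k x = TLap h x - TLap l x := by rw [hkl]; ring
        rw [this]
        refine (norm_sub_le _ _).trans ?_
        rw [Complex.ofReal_re] at h2
        linarith
      rw [hEn, Complex.ofReal_re]
      calc _ ≤ Real.exp (a * x) * ((C + ∫ t, ‖l t‖) * Real.exp (-a * x)) := by gcongr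
        _ = (C + ∫ t, ‖l t‖) * (Real.exp (a * x) * Real.exp (-a * x)) := by ring
        _ = _ := by rw [← Real.exp_add]; simp
  have hb : Bornology.IsBounded (range E) := by
    refine (isBounded_iff_forall_norm_le).2 ⟨M, ?_⟩
    rintro _ ⟨z, rfl⟩
    rcases le_total z.re 0 with h | h
    · exact hleft z h
    · exact hright z h
  have hconst : ∀ z, E z = E 0 := fun z => hEd.apply_eq_apply_of_bounded hb z 0
  have hlim : Filter.Tendsto (fun n : ℕ => E (-(n:ℂ))) Filter.atTop (nhds 0) := by
    have e : ∀ n : ℕ, E (-(n:ℂ)) = ∫ t : ℝ, Complex.exp (-(n:ℂ) * (a - t)) * k t := by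
      intro n
      simp only [hE, TLap]
      rw [← integral_const_mul]
      congr 1; ext t
      rw [← mul_assoc, ← Complex.exp_add]
      congr 2; ring
    simp only [e]
    rw [show (0:ℂ) = ∫ t : ℝ, (0:ℂ) by simp]
    refine tendsto_integral_of_dominated_convergence (fun t => ‖k t‖) (fun n => ?_) gk.int.norm
      (fun n => Filter.Eventually.of_forall fun t => ?_) (Filter.Eventually.of_forall fun t => ?_)
    · exact (gk.mul_cont (by fun_prop)).int.aestronglyMeasurable
    · by_cases ht : t < a
      · rw [norm_mul, Complex.norm_exp]
        refine mul_le_of_le_one_left (norm_nonneg _) (Real.exp_le_one_iff.2 ?_)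
        have : (-(n:ℂ) * (a - t)).re = -(n * (a - t)) := by simp
        rw [this]
        have := mul_nonneg (Nat.cast_nonneg (α := ℝ) n) (sub_nonneg.2 ht.le)
        linarith
      · simp [hk, indicator, ht]
    · by_cases ht : t < a
      · rw [← zero_mul (k t)]
        refine Filter.Tendsto.mul_const _ ?_
        rw [tendsto_zero_iff_norm_tendsto_zero]
        have : ∀ n : ℕ, ‖Complex.exp (-(n:ℂ) * (a - t))‖ = Real.exp (-(n * (a - t))) := by
          intro n; rw [Complex.norm_exp]; congr 1; simp
        simp only [this]
        refine Real.tendsto_exp_neg_atTop_nhds_zero.comp ?_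
        exact tendsto_natCast_atTop_atTop.atTop_mul_const (sub_pos.2 ht)
      · simp [hk, indicator, ht]
  have h0 : E 0 = 0 := by
    simp only [hconst] at hlim
    have h5 : (fun n : ℕ => E (-(n:ℂ))) = fun _ => E 0 := funext fun n => hconst _
    exact tendsto_nhds_unique (tendsto_const_nhds) hlim
  have hk0 : ∀ᵐ t, k t = 0 := gk.lap_inj fun z => by
    have := hconst z
    rw [h0] at this
    simpa [hE] using this
  filter_upwards [hk0] with t ht h1
  simpa [hk, indicator, h1] using ht

noncomputable def Tcv (f g : ℝ → ℂ) : ℝ → ℂ :=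
  convolution f g (ContinuousLinearMap.mul ℝ ℂ) volume

lemma Tcv_apply (f g : ℝ → ℂ) (t : ℝ) : Tcv f g t = ∫ s, f s * g (t - s) := rfl

lemma TGood.conv {R S : ℝ} {f g : ℝ → ℂ} (hf : TGood R f) (hg : TGood S g) :
    TGood (R + S) (Tcv f g) := by
  refine ⟨hf.int.integrable_convolution _ hg.int, fun t ht => ?_⟩
  rw [Tcv_apply]
  have : ∀ s, f s * g (t - s) = 0 := by
    intro s
    by_cases h1 : s ∈ Icc 0 R
    · rw [hg.supp, mul_zero]
      intro h2
      exact ht ⟨by linarith [h1.1, h2.1], by linarith [h1.2, h2.2]⟩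
    · rw [hf.supp s h1, zero_mul]
  simp [this]

lemma TLap_conv {R S : ℝ} {f g : ℝ → ℂ} (hf : TGood R f) (hg : TGood S g) (z : ℂ) :
    TLap (Tcv f g) z = TLap f z * TLap g z := by
  have := integral_convolution (ContinuousLinearMap.mul ℝ ℂ) (hf.exp z).int (hg.exp z).int
  rw [ContinuousLinearMap.mul_apply'] at this
  unfold TLap
  rw [← this]
  congr 1; ext t
  change _ = Tcv _ _ t
  rw [Tcv_apply, Tcv_apply, ← integral_const_mul]
  congr 1; ext s
  have : Complex.exp (-z * t) = Complex.exp (-z * s) * Complex.exp (-z * ((t - s : ℝ) : ℂ)) := by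
    rw [← Complex.exp_add]; congr 1; push_cast; ring
  rw [this]; ring

lemma Tcv_leibniz {R S : ℝ} {f g : ℝ → ℂ} (hf : TGood R f) (hg : TGood S g) :
    ∀ᵐ t : ℝ, Tcv (fun t : ℝ => (t:ℂ) * f t) g t + Tcv f (fun t : ℝ => (t:ℂ) * g t) t
      = t * Tcv f g t := by
  filter_upwards [hf.id.int.ae_convolution_exists (ContinuousLinearMap.mul ℝ ℂ) hg.int,
    hf.int.ae_convolution_exists (ContinuousLinearMap.mul ℝ ℂ) hg.id.int] with t h1 h2
  rw [Tcv_apply, Tcv_apply, Tcv_apply, ← integral_const_mul]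
  refine (integral_add h1 h2).symm.trans ?_
  congr 1; ext s
  simp only [ContinuousLinearMap.mul_apply']
  push_cast; ring

lemma Tstep1 {T : ℝ} (hT : 0 ≤ T) {f g : ℝ → ℂ} (hf : TGood T f) (hg : TGood T g)
    (h0 : ∀ᵐ t, t < T → Tcv f g t = 0) :
    ∀ᵐ t, t < T / 2 → Tcv f (fun t : ℝ => (t:ℂ) * g t) t = 0 := by
  set Df := fun t : ℝ => (t:ℂ) * f t with hDf
  set Dg := fun t : ℝ => (t:ℂ) * g t with hDg
  set w : ℝ → ℂ := fun t => Tcv Df g t + Tcv f Dg t with hw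
  have gDf : TGood T Df := hf.id
  have gDg : TGood T Dg := hg.id
  have g1 := hf.conv hg
  have g2 := gDf.conv hg
  have g3 := hf.conv gDg
  have g4 := gDf.conv gDg
  have hwi : Integrable w := g2.int.add g3.int
  have hw0 : ∀ᵐ t, t < T → w t = 0 := by
    filter_upwards [Tcv_leibniz hf hg, h0] with t h1 h2 h3
    rw [hw]; simp only
    rw [h1, h2 h3, mul_zero]
  have hwL : ∀ z, TLap w z = TLap Df z * TLap g z + TLap f z * TLap Dg z := by
    intro z
    rw [← TLap_conv gDf hg, ← TLap_conv hf gDg]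
    unfold TLap
    rw [← integral_add (g2.exp z).int (g3.exp z).int]
    simp only [hw, mul_add]
  set Φ := TLap (Tcv f Dg) with hΦ
  have hsq : ∀ z, Φ z ^ 2 = Φ z * TLap w z - TLap (Tcv Df Dg) z * TLap (Tcv f g) z := by
    intro z
    rw [hwL, TLap_conv gDf gDg, TLap_conv hf hg, hΦ, TLap_conv hf gDg]
    ring
  have b0 : ∀ {h : ℝ → ℂ}, TGood (T + T) h → ∀ x : ℝ, 0 ≤ x → ‖TLap h x‖ ≤ ∫ t, ‖h t‖ := by
    intro h hh x hx
    have := TLap_bound_right hh.int 0 (Filter.Eventually.of_forall fun t ht => 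
        hh.supp t (fun h => absurd h.1 (not_le.2 ht))) x (by simpa using hx)
    simpa using this
  set A := ∫ t, ‖Tcv f Dg t‖
  set B := ∫ t, ‖w t‖
  set C := ∫ t, ‖Tcv Df Dg t‖
  set D := ∫ t, ‖Tcv f g t‖
  have hA : 0 ≤ A := integral_nonneg fun t => norm_nonneg _
  have hB : 0 ≤ B := integral_nonneg fun t => norm_nonneg _
  have hC : 0 ≤ C := integral_nonneg fun t => norm_nonneg _
  have hD : 0 ≤ D := integral_nonneg fun t => norm_nonneg _
  refine g3.key (T / 2) (Real.sqrt (A * B + C * D)) (by linarith) fun x hx => ?_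
  have e1 := b0 g3 x hx
  have e2 := b0 g4 x hx
  have e3 := TLap_bound_right hwi T hw0 x (by simpa using hx)
  have e4 := TLap_bound_right g1.int T h0 x (by simpa using hx)
  rw [Complex.ofReal_re] at e3 e4
  have e5 : ‖Φ x‖ ^ 2 ≤ (A * B + C * D) * Real.exp (-T * x) := by
    rw [← norm_pow, hsq]
    refine (norm_sub_le _ _).trans ?_
    rw [norm_mul, norm_mul]
    calc _ ≤ A * (Real.exp (-T * x) * B) + C * (Real.exp (-T * x) * D) := by
          gcongr
      _ = _ := by ring
  refine (sq_le_sq₀ (norm_nonneg _) (by positivity)).1 ?_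
  rw [mul_pow, Real.sq_sqrt (by positivity), ← Real.exp_nat_mul]
  convert! e5 using 3
  push_cast; ring

/-- locally integrable, supported on the nonnegative half-line -/
structure TLoc (f : ℝ → ℂ) : Prop where
  int : ∀ T, IntegrableOn f (Icc 0 T) volume
  supp : ∀ t, t < 0 → f t = 0

lemma TLoc.good {f : ℝ → ℂ} (hf : TLoc f) (T : ℝ) : TGood T ((Icc 0 T).indicator f) :=
  ⟨(integrable_indicator_iff measurableSet_Icc).2 (hf.int T), fun t ht => by simp [ht]⟩

lemma TLoc.trunc {f g : ℝ → ℂ} (hf : TLoc f) (hg : TLoc g) {T t : ℝ} (ht : t ≤ T) (s : ℝ) :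
    (Icc 0 T).indicator f s * (Icc 0 T).indicator g (t - s) = f s * g (t - s) := by
  rcases lt_or_ge s 0 with h | h
  · simp [hf.supp s h, indicator]
  rcases lt_or_ge (t - s) 0 with h' | h'
  · simp [hg.supp _ h', indicator]
  have m1 : s ∈ Icc 0 T := ⟨h, by linarith⟩
  have m2 : t - s ∈ Icc 0 T := ⟨h', by linarith⟩
  rw [indicator_of_mem m1, indicator_of_mem m2]

lemma TLoc.cv {f g : ℝ → ℂ} (hf : TLoc f) (hg : TLoc g) {T t : ℝ} (ht : t ≤ T) :
    Tcv ((Icc 0 T).indicator f) ((Icc 0 T).indicator g) t = Tcv f g t := by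
  simp only [Tcv_apply, hf.trunc hg ht]

lemma TLoc.id {f : ℝ → ℂ} (hf : TLoc f) : TLoc (fun t : ℝ => (t:ℂ) * f t) := by
  refine ⟨fun T => ?_, fun t ht => by simp [hf.supp t ht]⟩
  have := (hf.good T).id.int
  rw [← integrable_indicator_iff measurableSet_Icc]
  convert! this using 1
  ext t
  by_cases h : t ∈ Icc 0 T <;> simp [h]

lemma Tstep {f g : ℝ → ℂ} (hf : TLoc f) (hg : TLoc g) (h0 : ∀ᵐ t, Tcv f g t = 0) :
    ∀ᵐ t, Tcv f (fun t : ℝ => (t:ℂ) * g t) t = 0 := by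
  have : ∀ n : ℕ, ∀ᵐ t, t < (n:ℝ) / 2 → Tcv f (fun t : ℝ => (t:ℂ) * g t) t = 0 := by
    intro n
    have := Tstep1 (Nat.cast_nonneg n) (hf.good n) (hg.good n) (by
      filter_upwards [h0] with t ht h1
      rw [hf.cv hg h1.le, ht])
    filter_upwards [this] with t h1 h2
    have h3 : (0:ℝ) ≤ n := Nat.cast_nonneg n
    rw [← hf.cv hg.id (T := n) (by linarith), ← h1 h2]
    congr 1
    ext s
    by_cases h : s ∈ Icc (0:ℝ) n <;> simp [h]
  filter_upwards [ae_all_iff.2 this] with t ht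
  obtain ⟨n, hn⟩ := exists_nat_gt (2 * t)
  exact ht n (by linarith)

lemma Tmain {f g : ℝ → ℂ} (hf : TLoc f) (hg : TLoc g) (hfm : AEStronglyMeasurable f volume)
    (hgm : AEStronglyMeasurable g volume) (h0 : ∀ᵐ t, Tcv f g t = 0) :
    (∀ᵐ t, f t = 0) ∨ (∀ᵐ t, g t = 0) := by
  have hn : ∀ n : ℕ, TLoc (fun t : ℝ => (t:ℂ)^n * g t) ∧
      ∀ᵐ t, Tcv f (fun t : ℝ => (t:ℂ)^n * g t) t = 0 := by
    intro n
    induction n with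
    | zero => simpa using ⟨hg, h0⟩
    | succ n ih =>
      have e : (fun t : ℝ => (t:ℂ)^(n+1) * g t) = fun t : ℝ => (t:ℂ) * ((t:ℂ)^n * g t) := by
        ext t; ring
      rw [e]
      exact ⟨ih.1.id, Tstep hf ih.1 ih.2⟩
  have hex : ∀ᵐ t, Integrable (fun s => f s * g (t - s)) := by
    have : ∀ n : ℕ, ∀ᵐ t, t ≤ (n:ℝ) → Integrable (fun s => f s * g (t - s)) := by
      intro n
      filter_upwards [(hf.good n).int.ae_convolution_exists (ContinuousLinearMap.mul ℝ ℂ)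
        (hg.good n).int] with t h1 h2
      refine Integrable.congr h1 (Filter.Eventually.of_forall fun s => ?_)
      simp only [ContinuousLinearMap.mul_apply']
      exact hf.trunc hg h2 s
    filter_upwards [ae_all_iff.2 this] with t ht
    obtain ⟨n, hn⟩ := exists_nat_ge t
    exact ht n hn
  have hz : ∀ᵐ t, ∀ᵐ s, f s * g (t - s) = 0 := by
    filter_upwards [hex, ae_all_iff.2 fun n => (hn n).2] with t h1 h2
    have h3 : ∀ᵐ u, f (t - u) * g u = 0 := by
      refine TGood.moment (R := t) ⟨?_, fun u hu => ?_⟩ fun n => ?_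
      · have := h1.comp_sub_left t
        simpa using this
      · rcases lt_or_ge u 0 with h | h
        · simp [hg.supp u h]
        · have : t < u := by
            by_contra h'
            exact hu ⟨h, not_lt.1 h'⟩
          rw [hf.supp (t - u) (by linarith), zero_mul]
      · have := h2 n
        rw [Tcv, convolution_eq_swap] at this
        rw [← this]
        congr 1; ext u
        simp only [ContinuousLinearMap.mul_apply']
        ring
    have := (Measure.measurePreserving_sub_left volume t).quasiMeasurePreserving.ae h3
    simpa using this
  have hm : AEStronglyMeasurable (fun p : ℝ × ℝ => f p.2 * g (p.1 - p.2)) (volume.prod volume) :=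
    hfm.convolution_integrand (ContinuousLinearMap.mul ℝ ℂ) hgm
  have hI : ∫⁻ t, ∫⁻ s, ‖f s * g (t - s)‖ₑ = 0 := by
    rw [← lintegral_zero (μ := (volume : Measure ℝ))]
    refine lintegral_congr_ae ?_
    filter_upwards [hz] with t ht
    rw [← lintegral_zero (μ := (volume : Measure ℝ))]
    refine lintegral_congr_ae ?_
    filter_upwards [ht] with s hs
    simp [hs]
  rw [lintegral_lintegral_swap hm.enorm] at hI
  simp only [enorm_mul] at hI
  have e : ∀ s, ∫⁻ t, ‖f s‖ₑ * ‖g (t - s)‖ₑ = ‖f s‖ₑ * ∫⁻ t, ‖g t‖ₑ := by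
    intro s
    rw [lintegral_const_mul' _ _ (by simp), lintegral_sub_right_eq_self (fun t => ‖g t‖ₑ)]
  simp only [e] at hI
  rw [lintegral_mul_const'' _ hfm.enorm, mul_eq_zero] at hI
  refine hI.imp (fun h => ?_) (fun h => ?_)
  · rw [lintegral_eq_zero_iff' hfm.enorm] at h
    filter_upwards [h] with t ht
    simpa using ht
  · rw [lintegral_eq_zero_iff' hgm.enorm] at h
    filter_upwards [h] with t ht
    simpa using ht

lemma TLoc_shift {f : ℝ → ℂ} (hf : LocallyIntegrable f volume) {a : ℝ}
    (ha : Function.support f ⊆ Ici a) : TLoc (fun x => f (x + a)) := by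
  refine ⟨fun T => ?_, fun t ht => ?_⟩
  · have h1 : IntegrableOn f (Icc a (T + a)) := hf.integrableOn_isCompact isCompact_Icc
    have h2 := (measurePreserving_add_right volume a).integrableOn_comp_preimage
      (measurableEmbedding_addRight a) (f := f) (s := Icc a (T + a))
    have := h2.2 h1
    convert! this using 1
    ext x; simp
  · by_contra h
    have : a ≤ t + a := ha h
    linarith

theorem stmt_15 (f g : ℝ → ℂ)
    (hf : LocallyIntegrable f volume) (hg : LocallyIntegrable g volume)
    (hfs : ∃ a : ℝ, Function.support f ⊆ Ici a)
    (hgs : ∃ b : ℝ, Function.support g ⊆ Ici b)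
    (hconv : ∀ᵐ t ∂volume,
      convolution f g (ContinuousLinearMap.mul ℝ ℂ) volume t = 0) :
    (∀ᵐ x ∂volume, f x = 0) ∨ (∀ᵐ x ∂volume, g x = 0) := by
  obtain ⟨a, ha⟩ := hfs
  obtain ⟨b, hb⟩ := hgs
  have hq : ∀ c : ℝ, Measure.QuasiMeasurePreserving (fun x : ℝ => x + c) volume volume :=
    fun c => (measurePreserving_add_right volume c).quasiMeasurePreserving
  have back : ∀ (h : ℝ → ℂ) (c : ℝ), (∀ᵐ x, h (x + c) = 0) → ∀ᵐ x, h x = 0 := by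
    intro h c hc
    simpa using (hq (-c)).ae hc
  have hm := Tmain (TLoc_shift hf ha) (TLoc_shift hg hb)
    (hf.aestronglyMeasurable.comp_quasiMeasurePreserving (hq a))
    (hg.aestronglyMeasurable.comp_quasiMeasurePreserving (hq b)) (by
      filter_upwards [(hq (a + b)).ae hconv] with t ht
      change Tcv f g _ = 0 at ht
      rw [Tcv_apply] at ht
      rw [Tcv_apply, ← ht, ← integral_add_right_eq_self (fun s => f s * g (t + (a + b) - s)) a]
      congr 1; ext s
      congr 2; ring)
  exact hm.imp (back f a) (back g b)
end
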